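/- arXiv:0911.4167 — 6 statements merged into one kernel-verified Lean document; each statement's English description precedes it below -/
import Mathlib

section
/- Let A, B, W be positive reals. For every real γ, (1 + (A+B)/W)/(1 + B·(γ²/A + (1−γ)²/W)) ≤ 1 + A/W, with equality if and only if γ = A/(A+W). Consequently, with A = νP and B = (1−ν)P for 0 < ν < 1, the DPC common-layer rate satisfies R_cc ≤ (1/2)·log₂(1 + νP/W), which is strictly smaller than (1/2)·log₂(1 + P/W). -/
/-- Completing the square: the gap between the SNR ratio of dirty paper coding and `1 + A / W`,
after clearing the denominator, is a nonnegative multiple of `(γ * (A + W) - A) ^ 2`. -/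
theorem dpc_gap_eq {A W : ℝ} (hA : A ≠ 0) (hW : W ≠ 0) (B γ : ℝ) :
    (1 + A / W) * (1 + B * (γ ^ 2 / A + (1 - γ) ^ 2 / W)) - (1 + (A + B) / W) =
      B / (A * W ^ 2) * (γ * (A + W) - A) ^ 2 := by
  field_simp
  ring

theorem dpc_denom_pos {A B W : ℝ} (hA : 0 < A) (hB : 0 < B) (hW : 0 < W) (γ : ℝ) :
    0 < 1 + B * (γ ^ 2 / A + (1 - γ) ^ 2 / W) := by
  positivity

theorem dpc_ratio_le {A B W : ℝ} (hA : 0 < A) (hB : 0 < B) (hW : 0 < W) (γ : ℝ) :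
    (1 + (A + B) / W) / (1 + B * (γ ^ 2 / A + (1 - γ) ^ 2 / W)) ≤ 1 + A / W := by
  rw [div_le_iff₀ (dpc_denom_pos hA hB hW γ), ← sub_nonneg, dpc_gap_eq hA.ne' hW.ne']
  positivity

theorem dpc_ratio_eq_iff {A B W : ℝ} (hA : 0 < A) (hB : 0 < B) (hW : 0 < W) (γ : ℝ) :
    (1 + (A + B) / W) / (1 + B * (γ ^ 2 / A + (1 - γ) ^ 2 / W)) = 1 + A / W ↔
      γ = A / (A + W) := by
  have hc : B / (A * W ^ 2) ≠ 0 := by positivity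
  rw [div_eq_iff (dpc_denom_pos hA hB hW γ).ne', eq_comm, ← sub_eq_zero,
    dpc_gap_eq hA.ne' hW.ne', mul_eq_zero_iff_left hc, sq_eq_zero_iff, sub_eq_zero,
    eq_div_iff (add_pos hA hW).ne']

/-- DPC over a Gaussian channel with signal power `A`, interference power `B`
and noise variance `W`: the SNR ratio inside the rate expression is at most
`1 + A/W`, with equality iff the Costa parameter is `γ = A/(A+W)`.
Consequently, with `A = νP`, `B = (1−ν)P` and `0 < ν < 1`, the common-layer
rate satisfies `R_cc ≤ (1/2)·log₂(1 + νP/W)`, which is strictly smaller than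
`(1/2)·log₂(1 + P/W)`. -/
theorem dpc_rate_bound
    (A B W : ℝ) (hA : 0 < A) (hB : 0 < B) (hW : 0 < W) :
    (∀ γ : ℝ,
      (1 + (A + B) / W) / (1 + B * (γ ^ 2 / A + (1 - γ) ^ 2 / W)) ≤ 1 + A / W ∧
      ((1 + (A + B) / W) / (1 + B * (γ ^ 2 / A + (1 - γ) ^ 2 / W)) = 1 + A / W ↔
        γ = A / (A + W))) ∧
    (∀ ν P : ℝ, 0 < ν → ν < 1 → 0 < P → A = ν * P → B = (1 - ν) * P →
      ∀ γ : ℝ,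
        (1 / 2) * Real.logb 2
            ((1 + (A + B) / W) / (1 + B * (γ ^ 2 / A + (1 - γ) ^ 2 / W))) ≤
          (1 / 2) * Real.logb 2 (1 + ν * P / W) ∧
        (1 / 2) * Real.logb 2 (1 + ν * P / W) <
          (1 / 2) * Real.logb 2 (1 + P / W)) := by
  refine ⟨fun γ => ⟨dpc_ratio_le hA hB hW γ, dpc_ratio_eq_iff hA hB hW γ⟩, ?_⟩
  intro ν P hν hν1 hP hAν _ γ
  have hd := dpc_denom_pos hA hB hW γ
  constructor
  · rw [← hAν]
    gcongr
    · norm_num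
    · exact dpc_ratio_le hA hB hW γ
  · have hlt : ν * P < P := mul_lt_of_lt_one_left hP hν1
    gcongr
    norm_num
end

section
/- Let P, W_c, W_r, N_c, N_r, D_c be positive reals with W_c ≥ W_r and N_c·W_c/(P + W_c) ≤ D_c ≤ N_c. Then both denominators below are positive and N_r·N_c²·W_r·D_c / ((D_c·N_c + N_r·(N_c − D_c))·((W_r − W_c)·N_c + (P + W_c)·D_c)) ≤ (N_r·W_r/(P + W_r)) · (D_c·N_c + (N_c·W_c/W_r)·(N_c − D_c)) / (D_c·N_c + N_r·(N_c − D_c)); i.e., for W_c ≥ W_r the LDS refinement distortion is at most the Scheme 3 refinement distortion at every common-layer distortion D_c. -/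
/-- Quadratic Gaussian WZBC at `κ = 1`, case `W_c ≥ W_r`: for every
common-layer distortion `D_c` in the admissible range, both factors of the
LDS denominator are positive and the LDS refinement distortion is at most
the Scheme 3 refinement distortion. -/
theorem lds_beats_scheme3_case_Wc_ge_Wr
    (P Wc Wr Nc Nr Dc : ℝ)
    (hP : 0 < P) (hWc : 0 < Wc) (hWr : 0 < Wr) (hNc : 0 < Nc) (hNr : 0 < Nr)
    (hDc : 0 < Dc) (hWcWr : Wc ≥ Wr)
    (hDclo : Nc * Wc / (P + Wc) ≤ Dc) (hDchi : Dc ≤ Nc) :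
    0 < Dc * Nc + Nr * (Nc - Dc) ∧
    0 < (Wr - Wc) * Nc + (P + Wc) * Dc ∧
    Nr * Nc ^ 2 * Wr * Dc /
        ((Dc * Nc + Nr * (Nc - Dc)) * ((Wr - Wc) * Nc + (P + Wc) * Dc)) ≤
      (Nr * Wr / (P + Wr)) *
        ((Dc * Nc + (Nc * Wc / Wr) * (Nc - Dc)) / (Dc * Nc + Nr * (Nc - Dc))) := by
  have hlo : Nc * Wc ≤ Dc * (P + Wc) := (div_le_iff₀ (by positivity)).1 hDclo
  have hA : 0 < Dc * Nc + Nr * (Nc - Dc) :=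
    add_pos_of_pos_of_nonneg (mul_pos hDc hNc) (mul_nonneg hNr.le (sub_nonneg.2 hDchi))
  have hB : 0 < (Wr - Wc) * Nc + (P + Wc) * Dc := by
    linarith [mul_pos hWr hNc]
  refine ⟨hA, hB, ?_⟩
  have hkey : 0 ≤ (Nc - Dc) * (Wc - Wr) * (Dc * (P + Wc) - Nc * Wc) :=
    mul_nonneg (mul_nonneg (sub_nonneg.2 hDchi) (sub_nonneg.2 hWcWr)) (sub_nonneg.2 hlo)
  have hdiff : (Nr * Wr / (P + Wr)) *
        ((Dc * Nc + (Nc * Wc / Wr) * (Nc - Dc)) / (Dc * Nc + Nr * (Nc - Dc))) -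
      Nr * Nc ^ 2 * Wr * Dc /
        ((Dc * Nc + Nr * (Nc - Dc)) * ((Wr - Wc) * Nc + (P + Wc) * Dc)) =
      Nr * Nc * ((Nc - Dc) * (Wc - Wr) * (Dc * (P + Wc) - Nc * Wc)) /
        ((P + Wr) * (Dc * Nc + Nr * (Nc - Dc)) * ((Wr - Wc) * Nc + (P + Wc) * Dc)) := by
    have hPW : P + Wr ≠ 0 := by positivity
    have hA' := hA.ne'
    have hB' := hB.ne'
    generalize Dc * Nc + Nr * (Nc - Dc) = A at hA' ⊢
    generalize hBdef : (Wr - Wc) * Nc + (P + Wc) * Dc = B at hB' ⊢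
    field_simp
    rw [← hBdef]
    ring
  rw [← sub_nonneg, hdiff]
  positivity
end

section
/- Let P, W_c, W_r, N_c, N_r, D_c be positive reals with W_c < W_r and N_c·W_c/(P + W_c) ≤ D_c ≤ N_c. Then N_r·N_c²·W_c / ((D_c·N_c + N_r·(N_c − D_c))·(P + W_c)) ≤ (N_r·W_r/(P + W_r)) · (D_c·N_c + (N_c·W_c/W_r)·(N_c − D_c)) / (D_c·N_c + N_r·(N_c − D_c)), with equality if and only if D_c = N_c·W_c/(P + W_c); i.e., for W_c < W_r the LDS refinement distortion is at most the Scheme 3 refinement distortion at every common-layer distortion D_c. -/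
/-- The gap between the Scheme 3 and LDS refinement distortions is a multiple of
`D_c - N_c·W_c/(P + W_c)`. -/
theorem scheme3_sub_lds_eq (P Wc Wr Nc Nr Dc : ℝ) (hWr : Wr ≠ 0) (hPc : P + Wc ≠ 0)
    (hPr : P + Wr ≠ 0) (hE : Dc * Nc + Nr * (Nc - Dc) ≠ 0) :
    (Nr * Wr / (P + Wr)) *
        ((Dc * Nc + (Nc * Wc / Wr) * (Nc - Dc)) / (Dc * Nc + Nr * (Nc - Dc))) -
      Nr * Nc ^ 2 * Wc / ((Dc * Nc + Nr * (Nc - Dc)) * (P + Wc)) =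
    Nr * Nc * (Wr - Wc) / ((Dc * Nc + Nr * (Nc - Dc)) * (P + Wr)) *
      (Dc - Nc * Wc / (P + Wc)) := by
  generalize Dc * Nc + Nr * (Nc - Dc) = E at *
  field_simp
  ring

/-- Quadratic Gaussian WZBC at `κ = 1`, case `W_c < W_r`: for every
common-layer distortion `D_c` in the admissible range, the LDS refinement
distortion is at most the Scheme 3 refinement distortion, with equality iff
`D_c = N_c·W_c/(P + W_c)`. -/
theorem lds_beats_scheme3_case_Wc_lt_Wr
    (P Wc Wr Nc Nr Dc : ℝ)
    (hP : 0 < P) (hWc : 0 < Wc) (hWr : 0 < Wr) (hNc : 0 < Nc) (hNr : 0 < Nr)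
    (hDc : 0 < Dc) (hWcWr : Wc < Wr)
    (hDclo : Nc * Wc / (P + Wc) ≤ Dc) (hDchi : Dc ≤ Nc) :
    Nr * Nc ^ 2 * Wc / ((Dc * Nc + Nr * (Nc - Dc)) * (P + Wc)) ≤
      (Nr * Wr / (P + Wr)) *
        ((Dc * Nc + (Nc * Wc / Wr) * (Nc - Dc)) / (Dc * Nc + Nr * (Nc - Dc))) ∧
    (Nr * Nc ^ 2 * Wc / ((Dc * Nc + Nr * (Nc - Dc)) * (P + Wc)) =
        (Nr * Wr / (P + Wr)) *
          ((Dc * Nc + (Nc * Wc / Wr) * (Nc - Dc)) / (Dc * Nc + Nr * (Nc - Dc))) ↔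
      Dc = Nc * Wc / (P + Wc)) := by
  have hE : 0 < Dc * Nc + Nr * (Nc - Dc) :=
    add_pos_of_pos_of_nonneg (mul_pos hDc hNc) (mul_nonneg hNr.le (sub_nonneg.2 hDchi))
  have hgap := scheme3_sub_lds_eq P Wc Wr Nc Nr Dc hWr.ne' (add_pos hP hWc).ne'
    (add_pos hP hWr).ne' hE.ne'
  have hcoef : 0 < Nr * Nc * (Wr - Wc) / ((Dc * Nc + Nr * (Nc - Dc)) * (P + Wr)) :=
    div_pos (mul_pos (mul_pos hNr hNc) (sub_pos.2 hWcWr)) (mul_pos hE (add_pos hP hWr))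
  constructor
  · rw [← sub_nonneg, hgap]
    exact mul_nonneg hcoef.le (sub_nonneg.2 hDclo)
  · rw [eq_comm, ← sub_eq_zero, hgap, mul_eq_zero, or_iff_right hcoef.ne', sub_eq_zero]
end

section
/- Let P, W_c, W_r, N_c, N_r, D_c be positive reals with W_c > W_r, N_c < N_r, 0 < D_c ≤ N_c, and (W_r − W_c)·N_c + (P + W_c)·D_c > 0. Then N_r·N_c²·W_r·D_c / ((D_c·N_c + N_r·(N_c − D_c))·((W_r − W_c)·N_c + (P + W_c)·D_c)) ≤ N_r·W_r·D_c / ((W_r − W_c)·N_c + (P + W_c)·D_c), with equality if and only if D_c = N_c. Equivalently, N_c² ≤ D_c·N_c + N_r·(N_c − D_c) with equality iff D_c = N_c; hence when W_c > W_r and N_c < N_r, LDS strictly outperforms separate source-channel coding unless D_c = N_c. -/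
/-- Quadratic Gaussian WZBC at `κ = 1`, with `W_c > W_r` and `N_c < N_r`:
the LDS refinement distortion is at most the separate-coding lower bound,
with equality iff `D_c = N_c`; equivalently
`N_c² ≤ D_c·N_c + N_r·(N_c − D_c)` with equality iff `D_c = N_c`. -/
theorem lds_beats_separate_case_worse_channel_better_side
    (P Wc Wr Nc Nr Dc : ℝ)
    (hP : 0 < P) (hWc : 0 < Wc) (hWr : 0 < Wr) (hNc : 0 < Nc) (hNr : 0 < Nr)
    (hDc : 0 < Dc) (hWcWr : Wc > Wr) (hNcNr : Nc < Nr)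
    (hDchi : Dc ≤ Nc)
    (hden : 0 < (Wr - Wc) * Nc + (P + Wc) * Dc) :
    (Nr * Nc ^ 2 * Wr * Dc /
        ((Dc * Nc + Nr * (Nc - Dc)) * ((Wr - Wc) * Nc + (P + Wc) * Dc)) ≤
      Nr * Wr * Dc / ((Wr - Wc) * Nc + (P + Wc) * Dc)) ∧
    (Nr * Nc ^ 2 * Wr * Dc /
        ((Dc * Nc + Nr * (Nc - Dc)) * ((Wr - Wc) * Nc + (P + Wc) * Dc)) =
      Nr * Wr * Dc / ((Wr - Wc) * Nc + (P + Wc) * Dc) ↔ Dc = Nc) ∧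
    (Nc ^ 2 ≤ Dc * Nc + Nr * (Nc - Dc)) ∧
    (Nc ^ 2 = Dc * Nc + Nr * (Nc - Dc) ↔ Dc = Nc) := by
  have hgap : Dc * Nc + Nr * (Nc - Dc) = Nc ^ 2 + (Nr - Nc) * (Nc - Dc) := by ring
  have hle : Nc ^ 2 ≤ Dc * Nc + Nr * (Nc - Dc) := by
    rw [hgap]
    exact le_add_of_nonneg_right
      (mul_nonneg (sub_nonneg.2 hNcNr.le) (sub_nonneg.2 hDchi))
  have heq : Nc ^ 2 = Dc * Nc + Nr * (Nc - Dc) ↔ Dc = Nc := by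
    rw [hgap, left_eq_add, mul_eq_zero_iff_left (sub_pos.2 hNcNr).ne', sub_eq_zero, eq_comm]
  have hA : 0 < Dc * Nc + Nr * (Nc - Dc) := (pow_pos hNc 2).trans_le hle
  generalize Dc * Nc + Nr * (Nc - Dc) = A at *
  generalize (Wr - Wc) * Nc + (P + Wc) * Dc = B at *
  have hR : 0 < Nr * Wr * Dc / B := by positivity
  have hfactor : Nr * Nc ^ 2 * Wr * Dc / (A * B) = Nc ^ 2 / A * (Nr * Wr * Dc / B) := by
    rw [div_mul_div_comm]
    ring
  rw [hfactor]
  refine ⟨mul_le_of_le_one_left hR.le ((div_le_one hA).2 hle), ?_, hle, heq⟩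
  rw [mul_eq_right₀ hR.ne', div_eq_one_iff_eq hA.ne', heq]
end

section
/- Let P, W_b, W_g, N_b, N_g, D_b, D_g be positive reals with W_g < W_b, N_g > N_b, and N_b·W_b/(P + W_b) ≤ D_b ≤ N_b. Set T = ((W_g − W_b)·N_b + (P + W_b)·D_b)/(D_b·W_g). Then T > 0, and the condition N_g ≤ T · min{D_g, D_b + D_b·D_g·(N_g − N_b)/(N_b·N_g)} holds if and only if D_g ≥ (N_g/((W_g − W_b)·N_b + (P + W_b)·D_b)) · max{W_g·D_b, N_b·(N_g·W_g − (P + W_b)·D_b − N_b·(W_g − W_b))/(N_g − N_b)}. -/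
/-- Separate coding for the quadratic Gaussian WZBC at `κ = 1`, case
`X − Y_b − Y_g` (with `W_g < W_b` and `N_g > N_b`): with
`T = ((W_g − W_b)N_b + (P + W_b)D_b)/(D_b·W_g)`, one has `T > 0`, and the
good-receiver constraint `N_g ≤ T·min{D_g, D_b + D_bD_g(N_g − N_b)/(N_bN_g)}`
holds iff `D_g` is at least the closed-form bound `D_SEP*(D_b)`. -/
theorem separate_coding_closed_form_bad_side
    (P Wb Wg Nb Ng Db Dg T : ℝ)
    (hP : 0 < P) (hWb : 0 < Wb) (hWg : 0 < Wg) (hNb : 0 < Nb) (hNg : 0 < Ng)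
    (hDb : 0 < Db) (hDg : 0 < Dg) (hWgWb : Wg < Wb) (hNgNb : Ng > Nb)
    (hDblo : Nb * Wb / (P + Wb) ≤ Db) (hDbhi : Db ≤ Nb)
    (hT : T = ((Wg - Wb) * Nb + (P + Wb) * Db) / (Db * Wg)) :
    0 < T ∧
      (Ng ≤ T * min Dg (Db + Db * Dg * (Ng - Nb) / (Nb * Ng)) ↔
        Dg ≥ (Ng / ((Wg - Wb) * Nb + (P + Wb) * Db)) *
          max (Wg * Db)
            (Nb * (Ng * Wg - (P + Wb) * Db - Nb * (Wg - Wb)) / (Ng - Nb))) := by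
  have hS : 0 < (Wg - Wb) * Nb + (P + Wb) * Db := by
    have h := (div_le_iff₀ (by positivity)).mp hDblo
    nlinarith [mul_pos hWg hNb]
  have hd : 0 < Ng - Nb := sub_pos.mpr hNgNb
  have hnum : Ng * Wg - (P + Wb) * Db - Nb * (Wg - Wb)
      = Ng * Wg - ((Wg - Wb) * Nb + (P + Wb) * Db) := by ring
  rw [hnum]
  generalize (Wg - Wb) * Nb + (P + Wb) * Db = S at *
  generalize Ng - Nb = d at *
  have hTpos : 0 < T := by rw [hT]; positivity
  refine ⟨hTpos, ?_⟩
  rw [mul_min_of_nonneg _ _ hTpos.le, le_min_iff, ge_iff_le,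
    mul_max_of_nonneg _ _ (by positivity), max_le_iff, hT]
  refine and_congr ?_ ?_
  · rw [div_mul_eq_mul_div, div_mul_eq_mul_div, le_div_iff₀ (by positivity),
      div_le_iff₀ hS, mul_comm S Dg, mul_comm Db Wg]
  · have h₁ : S / (Db * Wg) * (Db + Db * Dg * d / (Nb * Ng))
        = S * (Nb * Ng + Dg * d) / (Wg * (Nb * Ng)) := by
      field_simp
    have h₂ : Ng / S * (Nb * (Ng * Wg - S) / d)
        = Ng * (Nb * (Ng * Wg - S)) / (S * d) := by
      field_simp
    rw [h₁, h₂, le_div_iff₀ (by positivity), div_le_iff₀ (by positivity)]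
    constructor <;> intro h <;> linarith
end

section
/- Let β ∈ [0, 1/2] and let 0 ≤ α₁ ≤ α₂ ≤ 1/2. Then H₂(α₂ ⋆ β) − H₂(α₂) ≤ H₂(α₁ ⋆ β) − H₂(α₁). Here H₂(p) = −p·log₂ p − (1−p)·log₂(1−p) is the binary entropy function and a ⋆ b = (1−a)b + a(1−b) is binary convolution. In words, the function r(α,β) = H₂(α⋆β) − H₂(α) is monotone decreasing in α on [0, 1/2]. -/
/-- The binary entropy function `H₂(p) = −p·log₂ p − (1−p)·log₂(1−p)`. -/
noncomputable def binEntropy (p : ℝ) : ℝ :=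
  -p * Real.logb 2 p - (1 - p) * Real.logb 2 (1 - p)

/-- Binary convolution `a ⋆ b = (1−a)b + a(1−b)`. -/
def binConv (a b : ℝ) : ℝ := (1 - a) * b + a * (1 - b)

theorem binEntropy_eq_div_log_two (p : ℝ) : binEntropy p = Real.binEntropy p / Real.log 2 := by
  rw [binEntropy, Real.binEntropy_eq_negMulLog_add_negMulLog_one_sub]
  simp only [Real.logb, Real.negMulLog]
  ring

theorem binConv_eq_add (a b : ℝ) : binConv a b = a + b * (1 - 2 * a) := by
  rw [binConv]
  ring

theorem hasDerivAt_binConv_left (a b : ℝ) : HasDerivAt (fun x => binConv x b) (1 - 2 * b) a := by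
  have h := (((hasDerivAt_id a).const_sub 1).mul_const b).add
    ((hasDerivAt_id a).mul_const (1 - b))
  exact h.congr_deriv (by ring)

theorem continuous_binConv_left (b : ℝ) : Continuous fun x => binConv x b :=
  continuous_iff_continuousAt.2 fun a => (hasDerivAt_binConv_left a b).continuousAt

theorem antitoneOn_binEntropy_binConv_sub {b : ℝ} (hb0 : 0 ≤ b) (hb : b ≤ 1 / 2) :
    AntitoneOn (fun a => Real.binEntropy (binConv a b) - Real.binEntropy a)
      (Set.Icc 0 (1 / 2)) := by
  refine antitoneOn_of_hasDerivWithinAt_nonpos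
    (f' := fun a => (Real.log (1 - binConv a b) - Real.log (binConv a b)) * (1 - 2 * b) -
      (Real.log (1 - a) - Real.log a)) (convex_Icc _ _) ?_ ?_ ?_
  · exact ((Real.binEntropy_continuous.comp (continuous_binConv_left b)).sub
      Real.binEntropy_continuous).continuousOn
  all_goals
    intro a ha
    rw [interior_Icc] at ha
    obtain ⟨ha0, ha1⟩ := ha
    have hle : a ≤ binConv a b := by rw [binConv_eq_add]; nlinarith
    have hhalf : binConv a b ≤ 1 / 2 := by rw [binConv_eq_add]; nlinarith
  · exact (((Real.hasDerivAt_binEntropy (by linarith) (by linarith)).comp a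
      (hasDerivAt_binConv_left a b)).sub
      (Real.hasDerivAt_binEntropy (by linarith) (by linarith))).hasDerivWithinAt
  · have h₁ : Real.log a ≤ Real.log (binConv a b) := Real.log_le_log ha0 hle
    have h₂ : Real.log (1 - binConv a b) ≤ Real.log (1 - a) :=
      Real.log_le_log (by linarith) (by linarith)
    have h₃ : Real.log (binConv a b) ≤ Real.log (1 - binConv a b) :=
      Real.log_le_log (by linarith) (by linarith)
    nlinarith [mul_nonneg hb0 (sub_nonneg.2 h₃)]

/-- The function `r(α,β) = H₂(α⋆β) − H₂(α)` is monotone decreasing in `α` on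
`[0, 1/2]`: for `β ∈ [0, 1/2]` and `0 ≤ α₁ ≤ α₂ ≤ 1/2`,
`H₂(α₂ ⋆ β) − H₂(α₂) ≤ H₂(α₁ ⋆ β) − H₂(α₁)`. -/
theorem binary_rate_anti_in_alpha
    (β α₁ α₂ : ℝ) (hβ0 : 0 ≤ β) (hβ : β ≤ 1 / 2)
    (hα₁0 : 0 ≤ α₁) (hα : α₁ ≤ α₂) (hα₂ : α₂ ≤ 1 / 2) :
    binEntropy (binConv α₂ β) - binEntropy α₂ ≤
      binEntropy (binConv α₁ β) - binEntropy α₁ := by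
  simp only [binEntropy_eq_div_log_two, ← sub_div]
  exact div_le_div_of_nonneg_right
    (antitoneOn_binEntropy_binConv_sub hβ0 hβ ⟨hα₁0, hα.trans hα₂⟩ ⟨hα₁0.trans hα, hα₂⟩ hα)
    (Real.log_nonneg one_le_two)
end
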